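/- Convergence of the value functions along the limit flow: there exist values V^∞(x) and V^∞(x,a) for every state x and action a such that lim_{t→∞} V^{f_{θ̄_t}}(x) = V^∞(x) and lim_{t→∞} V^{f_{θ̄_t}}(x,a) = V^∞(x,a); consequently Q̄_t(x,a) → V^∞(x,a) and Σ_a Q̄_t(x,a) f_{θ̄_t}(x,a) → V^∞(x) as t → ∞, and if Δ = min{ |V^∞(x,a) − V^∞(x)| : V^∞(x,a) ≠ V^∞(x) } > 0, there exists T₀ such that V^∞(x,a) − Δ/4 ≤ Q̄_t(x,a) ≤ V^∞(x,a) + Δ/4 for all t > T₀ and all (x,a). -/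

import Mathlib

open MeasureTheory Filter Set
open scoped Classical

noncomputable section

def softmaxPol {X A : Type*} [Fintype A] (θ : X → A → ℝ) (x : X) (a : A) : ℝ :=
  Real.exp (θ x a) / ∑ a', Real.exp (θ x a')

def explorePol {X A : Type*} [Fintype A] (η : ℝ) (θ : X → A → ℝ) (x : X) (a : A) : ℝ :=
  η / (Fintype.card A : ℝ) + (1 - η) * softmaxPol θ x a

def zetaN (N k : ℕ) : ℝ := (1 + (k : ℝ) / (N : ℝ))⁻¹

def etaN (N k : ℕ) : ℝ := (1 + (Real.log ((k : ℝ) / (N : ℝ) + 1)) ^ 2)⁻¹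

def zetaT (t : ℝ) : ℝ := (1 + t)⁻¹

def etaT (t : ℝ) : ℝ := (1 + (Real.log (t + 1)) ^ 2)⁻¹

def IsPolicy {X A : Type*} [Fintype A] (f : X → A → ℝ) : Prop :=
  (∀ x a, 0 ≤ f x a) ∧ ∀ x, ∑ a, f x a = 1

def ptilde {X A : Type*} (γ : ℝ) (p : X → A → X → ℝ) (μ : X → ℝ)
    (x : X) (a : A) (x' : X) : ℝ :=
  γ * p x a x' + (1 - γ) * μ x'

def actorKer {X A : Type*} (γ : ℝ) (p : X → A → X → ℝ) (μ : X → ℝ) (f : X → A → ℝ) :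
    X × A → X × A → ℝ :=
  fun ξ ξ' => ptilde γ p μ ξ.1 ξ.2 ξ'.1 * f ξ'.1 ξ'.2

def criticKer {X A : Type*} (p : X → A → X → ℝ) (g : X → A → ℝ) :
    X × A → X × A → ℝ :=
  fun ξ ξ' => p ξ.1 ξ.2 ξ'.1 * g ξ'.1 ξ'.2

def kpow {S : Type*} [Fintype S] [DecidableEq S] (K : S → S → ℝ) : ℕ → S → S → ℝ
  | 0 => fun ξ ξ' => if ξ = ξ' then 1 else 0
  | n + 1 => fun ξ ξ' => ∑ y, K ξ y * kpow K n y ξ'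

def IsStationaryDist {S : Type*} [Fintype S] (K : S → S → ℝ) (d : S → ℝ) : Prop :=
  (∀ ξ, 0 ≤ d ξ) ∧ (∑ ξ, d ξ = 1) ∧ ∀ ξ', d ξ' = ∑ ξ, d ξ * K ξ ξ'

def pathSum {X A : Type*} [Fintype X] [Fintype A] [DecidableEq X]
    (p : X → A → X → ℝ) : ℕ → X → A → X → ℝ
  | 0 => fun x _ x' => if x = x' then 1 else 0
  | 1 => fun x a x' => p x a x'
  | n + 2 => fun x a x' => ∑ x₁ : X, ∑ a₁ : A, p x a x₁ * pathSum p (n + 1) x₁ a₁ x'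

/-- Expected value of `q` after one transition, when the next action is drawn from `f`. -/
def nextMean {X A : Type*} [Fintype X] [Fintype A] (p : X → A → X → ℝ) (f q : X → A → ℝ)
    (x : X) (a : A) : ℝ :=
  ∑ x', p x a x' * ∑ a', f x' a' * q x' a'

section Averages

variable {ι : Type*} [Fintype ι] {w q : ι → ℝ} {B : ℝ}

lemma weighted_sum_le (hw : ∀ i, 0 ≤ w i) (hw1 : ∑ i, w i = 1) (h : ∀ i, q i ≤ B) :
    ∑ i, w i * q i ≤ B :=
  calc ∑ i, w i * q i ≤ ∑ i, w i * B :=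
        Finset.sum_le_sum fun i _ => mul_le_mul_of_nonneg_left (h i) (hw i)
    _ = B := by rw [← Finset.sum_mul, hw1, one_mul]

lemma le_weighted_sum (hw : ∀ i, 0 ≤ w i) (hw1 : ∑ i, w i = 1) (h : ∀ i, B ≤ q i) :
    B ≤ ∑ i, w i * q i :=
  calc B = ∑ i, w i * B := by rw [← Finset.sum_mul, hw1, one_mul]
    _ ≤ ∑ i, w i * q i :=
        Finset.sum_le_sum fun i _ => mul_le_mul_of_nonneg_left (h i) (hw i)

lemma abs_weighted_sum_le (hw : ∀ i, 0 ≤ w i) (hw1 : ∑ i, w i = 1) (h : ∀ i, |q i| ≤ B) :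
    |∑ i, w i * q i| ≤ B :=
  abs_le.2 ⟨le_weighted_sum hw hw1 fun i => (abs_le.1 (h i)).1,
    weighted_sum_le hw hw1 fun i => (abs_le.1 (h i)).2⟩

end Averages

section Policies

variable {X A : Type*} [Fintype A]

lemma sum_exp_pos [Nonempty A] (θ : X → A → ℝ) (x : X) : 0 < ∑ a, Real.exp (θ x a) :=
  Finset.sum_pos (fun _ _ => Real.exp_pos _) Finset.univ_nonempty

lemma isPolicy_softmaxPol [Nonempty A] (θ : X → A → ℝ) : IsPolicy (softmaxPol θ) :=
  ⟨fun x a => div_nonneg (Real.exp_pos _).le (sum_exp_pos θ x).le, fun x => by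
    simp only [softmaxPol, ← Finset.sum_div]
    exact div_self (sum_exp_pos θ x).ne'⟩

lemma isPolicy_explorePol [Nonempty A] {η : ℝ} (h0 : 0 ≤ η) (h1 : η ≤ 1) (θ : X → A → ℝ) :
    IsPolicy (explorePol η θ) := by
  have hs := isPolicy_softmaxPol θ
  refine ⟨fun x a => ?_, fun x => ?_⟩
  · have := hs.1 x a
    have : 0 ≤ 1 - η := by linarith
    unfold explorePol
    positivity
  · have hA : (Fintype.card A : ℝ) ≠ 0 := Nat.cast_ne_zero.2 Fintype.card_ne_zero
    simp only [explorePol, Finset.sum_add_distrib, ← Finset.mul_sum, hs.2 x, Finset.sum_const,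
      Finset.card_univ, nsmul_eq_mul]
    field_simp
    ring

lemma hasDerivAt_softmaxPol [Nonempty A] {θ : ℝ → X → A → ℝ} {θ' : A → ℝ} {t : ℝ} {x : X}
    (h : ∀ a, HasDerivAt (fun s => θ s x a) (θ' a) t) (a : A) :
    HasDerivAt (fun s => softmaxPol (θ s) x a)
      (softmaxPol (θ t) x a * (θ' a - ∑ b, softmaxPol (θ t) x b * θ' b)) t := by
  have hS := (sum_exp_pos (θ t) x).ne'
  have hd := (h a).exp.div (HasDerivAt.fun_sum fun b (_ : b ∈ Finset.univ) => (h b).exp) hS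
  refine HasDerivAt.congr_deriv (f := fun s => softmaxPol (θ s) x a) hd ?_
  simp only [softmaxPol, div_mul_eq_mul_div, ← Finset.sum_div]
  field_simp

lemma sum_softmax_deriv_mul {w θ' v : A → ℝ} :
    ∑ a, w a * (θ' a - ∑ b, w b * θ' b) * v a = ∑ a, w a * (θ' a * (v a - ∑ b, w b * v b)) := by
  have h1 : ∀ a, w a * (θ' a - ∑ b, w b * θ' b) * v a
      = w a * θ' a * v a - w a * v a * ∑ b, w b * θ' b := fun a => by ring
  have h2 : ∀ a, w a * (θ' a * (v a - ∑ b, w b * v b))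
      = w a * θ' a * v a - w a * θ' a * ∑ b, w b * v b := fun a => by ring
  simp only [h1, h2, Finset.sum_sub_distrib, ← Finset.sum_mul]
  ring

end Policies

section Bellman

variable {X A : Type*} [Fintype X] [Fintype A] {p : X → A → X → ℝ} {γ : ℝ}

lemma nextMean_add_right (f q q' : X → A → ℝ) (x : X) (a : A) :
    nextMean p f (fun x a => q x a + q' x a) x a = nextMean p f q x a + nextMean p f q' x a := by
  simp only [nextMean, mul_add, Finset.sum_add_distrib]

lemma nextMean_smul_right (c : ℝ) (f q : X → A → ℝ) (x : X) (a : A) :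
    nextMean p f (fun x a => c * q x a) x a = c * nextMean p f q x a := by
  simp only [nextMean, Finset.mul_sum]
  exact Finset.sum_congr rfl fun _ _ => Finset.sum_congr rfl fun _ _ => by ring

lemma nextMean_sub_right (f q q' : X → A → ℝ) (x : X) (a : A) :
    nextMean p f (fun x a => q x a - q' x a) x a = nextMean p f q x a - nextMean p f q' x a := by
  simp only [nextMean, mul_sub, Finset.sum_sub_distrib]

lemma nextMean_sub_left (f f' q : X → A → ℝ) (x : X) (a : A) :
    nextMean p (fun x a => f x a - f' x a) q x a = nextMean p f q x a - nextMean p f' q x a := by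
  simp only [nextMean, sub_mul, mul_sub, Finset.sum_sub_distrib]

lemma nextMean_smul_left (c : ℝ) (f q : X → A → ℝ) (x : X) (a : A) :
    nextMean p (fun x a => c * f x a) q x a = c * nextMean p f q x a := by
  simp only [nextMean, Finset.mul_sum]
  exact Finset.sum_congr rfl fun _ _ => Finset.sum_congr rfl fun _ _ => by ring

lemma abs_nextMean_le {f q : X → A → ℝ} {B : ℝ} (hp0 : ∀ x a x', 0 ≤ p x a x')
    (hp1 : ∀ x a, ∑ x', p x a x' = 1) (hf : IsPolicy f) (hq : ∀ x a, |q x a| ≤ B) (x : X) (a : A) :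
    |nextMean p f q x a| ≤ B :=
  abs_weighted_sum_le (hp0 x a) (hp1 x a) fun x' =>
    abs_weighted_sum_le (hf.1 x') (hf.2 x') (hq x')

/-- One-sided comparison principle for the discounted Bellman operator. -/
lemma bellman_lower_bound {f e : X → A → ℝ} {ε : ℝ} (hp0 : ∀ x a x', 0 ≤ p x a x')
    (hp1 : ∀ x a, ∑ x', p x a x' = 1) (hf : IsPolicy f) (hγ0 : 0 ≤ γ) (hγ1 : γ < 1)
    (he : ∀ x a, γ * nextMean p f e x a - ε ≤ e x a) (x : X) (a : A) :
    -(ε / (1 - γ)) ≤ e x a := by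
  have : Nonempty (X × A) := ⟨(x, a)⟩
  obtain ⟨ξ, hξ⟩ := Finite.exists_min fun ξ : X × A => e ξ.1 ξ.2
  have h1 : e ξ.1 ξ.2 ≤ nextMean p f e ξ.1 ξ.2 :=
    le_weighted_sum (hp0 _ _) (hp1 _ _) fun x' =>
      le_weighted_sum (hf.1 x') (hf.2 x') fun a' => hξ (x', a')
  have h2 := he ξ.1 ξ.2
  have h3 : -(ε / (1 - γ)) ≤ e ξ.1 ξ.2 := by
    rw [← neg_div, div_le_iff₀ (by linarith)]
    nlinarith [mul_le_mul_of_nonneg_left h1 hγ0]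
  exact h3.trans (hξ (x, a))

lemma abs_le_of_bellman_eq {f e c : X → A → ℝ} {ε : ℝ} (hp0 : ∀ x a x', 0 ≤ p x a x')
    (hp1 : ∀ x a, ∑ x', p x a x' = 1) (hf : IsPolicy f) (hγ0 : 0 ≤ γ) (hγ1 : γ < 1)
    (he : ∀ x a, e x a = c x a + γ * nextMean p f e x a) (hc : ∀ x a, |c x a| ≤ ε)
    (x : X) (a : A) : |e x a| ≤ ε / (1 - γ) := by
  refine abs_le.2 ⟨bellman_lower_bound hp0 hp1 hf hγ0 hγ1 (fun x a => ?_) x a, ?_⟩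
  · linarith [he x a, (abs_le.1 (hc x a)).1]
  · have := bellman_lower_bound (e := fun x a => (-1) * e x a) (ε := ε) hp0 hp1 hf hγ0 hγ1
      (fun x a => ?_) x a
    · linarith
    · rw [nextMean_smul_right]
      linarith [he x a, (abs_le.1 (hc x a)).2]

lemma exists_bellman_eq {f : X → A → ℝ} (hp0 : ∀ x a x', 0 ≤ p x a x')
    (hp1 : ∀ x a, ∑ x', p x a x' = 1) (hf : IsPolicy f) (hγ0 : 0 ≤ γ) (hγ1 : γ < 1)
    (b : X → A → ℝ) : ∃ e : X → A → ℝ, ∀ x a, e x a = b x a + γ * nextMean p f e x a := by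
  let L : (X → A → ℝ) →ₗ[ℝ] (X → A → ℝ) :=
    { toFun := fun e x a => e x a - γ * nextMean p f e x a
      map_add' := fun e e' => by
        ext x a
        have := nextMean_add_right (p := p) f e e' x a
        simp only [Pi.add_apply]
        rw [show e + e' = fun x a => e x a + e' x a from rfl, this]
        ring
      map_smul' := fun c e => by
        ext x a
        have := nextMean_smul_right (p := p) c f e x a
        simp only [Pi.smul_apply, smul_eq_mul, RingHom.id_apply]
        rw [show c • e = fun x a => c * e x a from rfl, this]
        ring }
  have hL : Function.Injective L := by
    refine (injective_iff_map_eq_zero L).2 fun e he => ?_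
    ext x a
    have h := abs_le_of_bellman_eq (c := fun _ _ => 0) (e := e) (ε := 0) hp0 hp1 hf hγ0 hγ1
      (fun x a => ?_) (by simp) x a
    · simpa using h
    · have : e x a - γ * nextMean p f e x a = 0 := congrFun (congrFun he x) a
      linarith
  obtain ⟨e, he⟩ := LinearMap.injective_iff_surjective.1 hL b
  refine ⟨e, fun x a => ?_⟩
  have : e x a - γ * nextMean p f e x a = b x a := congrFun (congrFun he x) a
  linarith

/-- Solutions of the Bellman equation are differentiable along a differentiable curve of policies,
and the derivative solves a Bellman equation itself. -/
lemma exists_hasDerivAt_bellman {r : X → A → ℝ} {f V : ℝ → X → A → ℝ} {f' : X → A → ℝ} {t : ℝ}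
    (hp0 : ∀ x a x', 0 ≤ p x a x') (hp1 : ∀ x a, ∑ x', p x a x' = 1)
    (hf : ∀ s, IsPolicy (f s)) (hγ0 : 0 ≤ γ) (hγ1 : γ < 1)
    (hV : ∀ s x a, V s x a = r x a + γ * nextMean p (f s) (V s) x a)
    (hf' : ∀ x a, HasDerivAt (fun s => f s x a) (f' x a) t) :
    ∃ E : X → A → ℝ,
      (∀ x a, E x a = γ * nextMean p f' (V t) x a + γ * nextMean p (f t) E x a) ∧
      ∀ x a, HasDerivAt (fun s => V s x a) (E x a) t := by
  obtain ⟨E, hE⟩ := exists_bellman_eq hp0 hp1 (hf t) hγ0 hγ1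
    (fun x a => γ * nextMean p f' (V t) x a)
  refine ⟨E, hE, fun x a => ?_⟩
  let c : ℝ → X → A → ℝ := fun s x a =>
    γ * nextMean p (fun x a => f s x a - f t x a) E x a +
      γ * nextMean p (fun x a => (s - t)⁻¹ * (f s x a - f t x a) - f' x a) (V t) x a
  have hslope : ∀ x a, Tendsto (fun s => (s - t)⁻¹ * (f s x a - f t x a)) (nhdsWithin t {t}ᶜ)
      (nhds (f' x a)) := fun x a => by
    simpa [slope_fun_def] using hasDerivAt_iff_tendsto_slope.1 (hf' x a)
  have hcont : ∀ x a, Tendsto (fun s => f s x a - f t x a) (nhdsWithin t {t}ᶜ) (nhds 0) :=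
    fun x a => by
      simpa using ((hf' x a).continuousAt.tendsto.mono_left nhdsWithin_le_nhds).sub_const (f t x a)
  have hc : Tendsto (fun s => ∑ y, ∑ b, |c s y b|) (nhdsWithin t {t}ᶜ) (nhds 0) := by
    have h0 : (0 : ℝ) = ∑ y : X, ∑ b : A, |γ * (∑ x', p y b x' * ∑ a', (0 : ℝ) * E x' a') +
        γ * (∑ x', p y b x' * ∑ a', (f' x' a' - f' x' a') * V t x' a')| := by simp
    rw [h0]
    refine tendsto_finsetSum _ fun y _ => tendsto_finsetSum _ fun b _ => Tendsto.abs ?_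
    refine (Tendsto.const_mul _ ?_).add (Tendsto.const_mul _ ?_)
    · exact tendsto_finsetSum _ fun x' _ => Tendsto.const_mul _ <|
        tendsto_finsetSum _ fun a' _ => (hcont x' a').mul_const _
    · exact tendsto_finsetSum _ fun x' _ => Tendsto.const_mul _ <|
        tendsto_finsetSum _ fun a' _ => ((hslope x' a').sub_const _).mul_const _
  rw [hasDerivAt_iff_tendsto_slope, tendsto_iff_norm_sub_tendsto_zero]
  have hc' : Tendsto (fun s => (∑ y, ∑ b, |c s y b|) / (1 - γ)) (nhdsWithin t {t}ᶜ) (nhds 0) := by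
    simpa using hc.div_const (1 - γ)
  refine squeeze_zero' (Eventually.of_forall fun s => norm_nonneg _) ?_ hc'
  filter_upwards [self_mem_nhdsWithin] with s hs
  have hst : s - t ≠ 0 := sub_ne_zero.2 hs
  have key := abs_le_of_bellman_eq (e := fun x a => (s - t)⁻¹ * (V s x a - V t x a) - E x a)
    (c := c s) (ε := ∑ y, ∑ b, |c s y b|) hp0 hp1 (hf s) hγ0 hγ1 (fun x a => ?_) (fun x a => ?_) x a
  · simpa [slope_def_field, div_eq_inv_mul] using key
  · simp only [c, nextMean_sub_left, nextMean_smul_left, nextMean_sub_right, nextMean_smul_right]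
    rw [hE x a, hV s x a, hV t x a]
    ring
  · exact (Finset.single_le_sum (f := fun b => |c s x b|) (fun _ _ => abs_nonneg _)
      (Finset.mem_univ a)).trans (Finset.single_le_sum (f := fun y => ∑ b, |c s y b|)
      (fun _ _ => Finset.sum_nonneg fun _ _ => abs_nonneg _) (Finset.mem_univ x))

end Bellman

section Kernels

variable {S : Type*} [Fintype S] [DecidableEq S] {K K' : S → S → ℝ} {d : S → ℝ}

lemma kpow_nonneg (hK : ∀ ξ ξ', 0 ≤ K ξ ξ') (n : ℕ) (ξ ξ' : S) : 0 ≤ kpow K n ξ ξ' := by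
  induction n generalizing ξ with
  | zero => simp only [kpow]; split_ifs <;> simp
  | succ n ih => exact Finset.sum_nonneg fun y _ => mul_nonneg (hK ξ y) (ih y)

lemma pow_mul_kpow_le {c : ℝ} (hc : 0 ≤ c) (hK : ∀ ξ ξ', 0 ≤ K ξ ξ')
    (h : ∀ ξ ξ', c * K ξ ξ' ≤ K' ξ ξ') (n : ℕ) (ξ ξ' : S) :
    c ^ n * kpow K n ξ ξ' ≤ kpow K' n ξ ξ' := by
  induction n generalizing ξ with
  | zero => simp [kpow]
  | succ n ih =>
    simp only [kpow, Finset.mul_sum]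
    refine Finset.sum_le_sum fun y _ => ?_
    calc c ^ (n + 1) * (K ξ y * kpow K n y ξ') = (c * K ξ y) * (c ^ n * kpow K n y ξ') := by ring
      _ ≤ K' ξ y * kpow K' n y ξ' :=
        mul_le_mul (h ξ y) (ih y) (mul_nonneg (pow_nonneg hc n) (kpow_nonneg hK n y ξ'))
          ((mul_nonneg hc (hK ξ y)).trans (h ξ y))

lemma IsStationaryDist.eq_sum_kpow (h : IsStationaryDist K d) (n : ℕ) (ξ' : S) :
    d ξ' = ∑ ξ, d ξ * kpow K n ξ ξ' := by
  induction n with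
  | zero => simp [kpow]
  | succ n ih =>
    simp only [kpow, Finset.mul_sum]
    rw [Finset.sum_comm, ih]
    refine Finset.sum_congr rfl fun y _ => ?_
    rw [h.2.2 y, Finset.sum_mul]
    exact Finset.sum_congr rfl fun ξ _ => by ring

/-- Minorization: a stationary distribution of `K'` inherits a lower bound from a positive power of
a kernel `K` with `c * K ≤ K'`. -/
lemma IsStationaryDist.lower_bound (h : IsStationaryDist K' d) {c δ : ℝ} (hc : 0 ≤ c)
    (hK : ∀ ξ ξ', 0 ≤ K ξ ξ') (hcK : ∀ ξ ξ', c * K ξ ξ' ≤ K' ξ ξ') {n : ℕ}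
    (hδ : ∀ ξ ξ', δ ≤ kpow K n ξ ξ') (ξ' : S) : c ^ n * δ ≤ d ξ' := by
  rw [h.eq_sum_kpow n ξ']
  exact le_weighted_sum h.1 h.2.1 fun ξ =>
    (mul_le_mul_of_nonneg_left (hδ ξ ξ') (pow_nonneg hc n)).trans
      (pow_mul_kpow_le hc hK hcK n ξ ξ')

end Kernels

lemma IsStationaryDist.exists_factor {X A : Type*} [Fintype X] [Fintype A] {γ : ℝ}
    {p : X → A → X → ℝ} {μ : X → ℝ} {f : X → A → ℝ} {d : X × A → ℝ} (hf : IsPolicy f)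
    (h : IsStationaryDist (actorKer γ p μ f) d) :
    ∃ m : X → ℝ, (∀ x, 0 ≤ m x ∧ m x ≤ 1) ∧ ∀ x a, d (x, a) = m x * f x a := by
  have hfac : ∀ x a, d (x, a) = (∑ ξ : X × A, d ξ * ptilde γ p μ ξ.1 ξ.2 x) * f x a := by
    intro x a
    rw [h.2.2 (x, a), Finset.sum_mul]
    exact Finset.sum_congr rfl fun ξ _ => by simp only [actorKer]; ring
  have hm : ∀ x, ∑ ξ : X × A, d ξ * ptilde γ p μ ξ.1 ξ.2 x = ∑ a, d (x, a) := fun x => by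
    simp only [hfac x, ← Finset.mul_sum, hf.2 x, mul_one]
  refine ⟨fun x => ∑ a, d (x, a), fun x => ⟨Finset.sum_nonneg fun a _ => h.1 _, ?_⟩, fun x a => ?_⟩
  · rw [← h.2.1, Fintype.sum_prod_type]
    exact Finset.single_le_sum (f := fun x => ∑ a, d (x, a))
      (fun y _ => Finset.sum_nonneg fun a _ => h.1 _) (Finset.mem_univ x)
  · exact (hfac x a).trans (by rw [hm x])

/-- Barrier principle: finitely many differentiable functions that start negative stay negative if
each of them has negative derivative whenever it is the first to reach zero. -/
lemma neg_of_barrier {ι : Type*} [Finite ι] {ψ ψ' : ι → ℝ → ℝ} {T : ℝ}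
    (hd : ∀ i t, T ≤ t → HasDerivAt (ψ i) (ψ' i t) t) (h0 : ∀ i, ψ i T < 0)
    (hb : ∀ i t, T ≤ t → (∀ j, ψ j t ≤ 0) → ψ i t = 0 → ψ' i t < 0) (i : ι) (t : ℝ) (ht : T ≤ t) :
    ψ i t < 0 := by
  by_contra! hcon
  have : Nonempty ι := ⟨i⟩
  let S : Set ℝ := ⋃ j, {s ∈ Icc T t | 0 ≤ ψ j s}
  have hS : IsCompact S := isCompact_iUnion fun j => by
    refine isCompact_Icc.of_isClosed_subset ?_ (sep_subset _ _)
    exact isClosed_Icc.isClosed_le continuousOn_const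
      fun s hs => (hd j s hs.1).continuousAt.continuousWithinAt
  obtain ⟨s, hs, hmin⟩ := hS.exists_isLeast ⟨t, mem_iUnion.2 ⟨i, ⟨ht, le_rfl⟩, hcon⟩⟩
  obtain ⟨j, ⟨hsT, hst⟩, hj⟩ := mem_iUnion.1 hs
  have hTs : T < s := lt_of_le_of_ne hsT fun h => by
    have := h0 j
    rw [h] at this
    linarith
  have hbefore : ∀ k, ∀ u ∈ Ico T s, ψ k u < 0 := fun k u hu => by
    by_contra! h
    exact absurd (hmin (mem_iUnion.2 ⟨k, ⟨hu.1, hu.2.le.trans hst⟩, h⟩)) (not_le.2 hu.2)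
  have hev : ∀ k, ∀ᶠ u in nhdsWithin s (Iio s), ψ k u < 0 := fun k => by
    filter_upwards [Ico_mem_nhdsLT hTs] with u hu using hbefore k u hu
  have hle : ∀ k, ψ k s ≤ 0 := fun k =>
    le_of_tendsto ((hd k s hsT).continuousAt.tendsto.mono_left nhdsWithin_le_nhds)
      ((hev k).mono fun _ h => h.le)
  have hz : ψ j s = 0 := le_antisymm (hle j) hj
  have hneg := hb j s hsT hle hz
  have hsl := (hasDerivAt_iff_tendsto_slope_left_right.1 (hd j s hsT)).1
  refine absurd (ge_of_tendsto hsl ?_) (not_le.2 hneg)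
  filter_upwards [hev j, self_mem_nhdsWithin] with u hu hus
  rw [slope_def_field, hz, sub_zero]
  exact (div_pos_of_neg_of_neg hu (sub_neg.2 hus)).le

section Rates

lemma etaT_pos (t : ℝ) : 0 < etaT t := by unfold etaT; positivity

lemma etaT_lt_one {t : ℝ} (ht : 0 < t) : etaT t < 1 := by
  have := Real.log_pos (show 1 < t + 1 by linarith)
  exact inv_lt_one_of_one_lt₀ (by nlinarith)

lemma hasDerivAt_etaT {t : ℝ} (ht : 0 ≤ t) :
    HasDerivAt etaT (-(2 * Real.log (t + 1) * zetaT t * etaT t ^ 2)) t := by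
  have h1 : HasDerivAt (fun s : ℝ => Real.log (s + 1)) (1 / (t + 1)) t :=
    ((hasDerivAt_id t).add_const 1).log (by simp; linarith)
  have h2 := ((h1.pow 2).const_add 1).inv (by positivity : 1 + Real.log (t + 1) ^ 2 ≠ 0)
  refine HasDerivAt.congr_deriv (f := etaT) h2 ?_
  simp only [etaT, zetaT, Pi.pow_apply]
  have : 1 + t ≠ 0 := by linarith
  have : t + 1 ≠ 0 := by linarith
  have : 1 + Real.log (t + 1) ^ 2 ≠ 0 := by positivity
  field_simp
  ring

lemma two_log_mul_etaT_le (t : ℝ) : 2 * Real.log (t + 1) * etaT t ≤ 1 := by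
  rw [etaT, ← div_eq_mul_inv, div_le_one (by positivity)]
  nlinarith [sq_nonneg (Real.log (t + 1) - 1)]

lemma hasDerivAt_arctan_log {t : ℝ} (ht : 0 ≤ t) :
    HasDerivAt (fun s => Real.arctan (Real.log (s + 1))) (zetaT t * etaT t) t := by
  have h1 : HasDerivAt (fun s : ℝ => Real.log (s + 1)) (1 / (t + 1)) t :=
    ((hasDerivAt_id t).add_const 1).log (by simp; linarith)
  convert h1.arctan using 1
  simp only [etaT, zetaT, one_div, add_comm t 1]
  ring

lemma tendsto_log_add_one : Tendsto (fun t : ℝ => Real.log (t + 1)) atTop atTop :=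
  Real.tendsto_log_atTop.comp (tendsto_atTop_add_const_right _ 1 tendsto_id)

lemma tendsto_etaT : Tendsto etaT atTop (nhds 0) :=
  tendsto_inv_atTop_zero.comp <| tendsto_atTop_add_const_left _ 1 <|
    (tendsto_pow_atTop two_ne_zero).comp tendsto_log_add_one

/-- The actor step size is eventually negligible against any power of the exploration rate. -/
lemma eventually_zetaT_lt {C c : ℝ} (hc : 0 < c) (n : ℕ) :
    ∀ᶠ t in atTop, C * zetaT t < c * etaT t ^ n := by
  have h1 : Tendsto (fun y : ℝ => (1 + y ^ 2) ^ n / Real.exp y) atTop (nhds 0) := by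
    have := ((1 + Polynomial.X ^ 2 : Polynomial ℝ) ^ n).tendsto_div_exp_atTop
    simpa only [Polynomial.eval_pow, Polynomial.eval_add, Polynomial.eval_one,
      Polynomial.eval_X] using this
  have h2 : Tendsto (fun t : ℝ => |C| * ((1 + Real.log (t + 1) ^ 2) ^ n /
      Real.exp (Real.log (t + 1)))) atTop (nhds 0) := by
    simpa using (h1.comp tendsto_log_add_one).const_mul |C|
  filter_upwards [h2.eventually_lt_const hc, eventually_gt_atTop 0] with t h ht
  rw [Real.exp_log (by linarith)] at h
  have hp : 0 < (1 + Real.log (t + 1) ^ 2) ^ n := by positivity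
  rw [etaT, zetaT, inv_pow, ← div_eq_mul_inv, ← div_eq_mul_inv, div_lt_div_iff₀ (by linarith) hp]
  rw [← mul_div_assoc, div_lt_iff₀ (by linarith)] at h
  nlinarith [le_abs_self C]

end Rates

/-- A bounded function that decreases at most at an integrable rate converges. -/
lemma exists_tendsto_of_deriv_lower_bound {u u' : ℝ → ℝ} {T B C : ℝ} (hT : 0 ≤ T)
    (hd : ∀ t, T ≤ t → HasDerivAt u (u' t) t) (hu : ∀ t, |u t| ≤ B) (hC : 0 ≤ C)
    (hl : ∀ t, T ≤ t → -(C * (zetaT t * etaT t)) ≤ u' t) :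
    ∃ l, Tendsto u atTop (nhds l) := by
  let w : ℝ → ℝ := fun t => C * Real.arctan (Real.log (t + 1))
  have hw : Tendsto w atTop (nhds (C * (Real.pi / 2))) :=
    ((Real.tendsto_arctan_atTop.mono_right nhdsWithin_le_nhds).comp
      tendsto_log_add_one).const_mul C
  have hdw : ∀ t, T ≤ t → HasDerivAt (fun s => u s + w s) (u' t + C * (zetaT t * etaT t)) t :=
    fun t ht => (hd t ht).add ((hasDerivAt_arctan_log (hT.trans ht)).const_mul C)
  have hmono : MonotoneOn (fun s => u s + w s) (Ici T) := by
    refine monotoneOn_of_hasDerivWithinAt_nonneg (convex_Ici T)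
      (fun t ht => (hdw t ht).continuousAt.continuousWithinAt)
      (fun t ht => (hdw t (interior_subset ht)).hasDerivWithinAt) fun t ht => ?_
    linarith [hl t (interior_subset ht)]
  have hm : Monotone fun s => u (max s T) + w (max s T) := fun s s' h =>
    hmono (mem_Ici.2 (le_max_right _ _)) (mem_Ici.2 (le_max_right _ _)) (max_le_max_right T h)
  have hbd : BddAbove (range fun s => u (max s T) + w (max s T)) := by
    refine ⟨B + C * (Real.pi / 2), ?_⟩
    rintro _ ⟨s, rfl⟩
    exact add_le_add (abs_le.1 (hu _)).2
      (mul_le_mul_of_nonneg_left (Real.arctan_lt_pi_div_two _).le hC)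
  refine ⟨_, ((tendsto_atTop_ciSup hm hbd).sub hw).congr' ?_⟩
  filter_upwards [eventually_ge_atTop T] with t ht
  simp [max_eq_left ht]

lemma abs_lt_of_barrier {ι : Type*} [Finite ι] {φ φ' : ι → ℝ → ℝ} {B B' : ℝ → ℝ} {T : ℝ}
    (hd : ∀ i t, T ≤ t → HasDerivAt (φ i) (φ' i t) t)
    (hB : ∀ t, T ≤ t → HasDerivAt B (B' t) t) (h0 : ∀ i, |φ i T| < B T)
    (hb : ∀ i t, T ≤ t → (∀ j, |φ j t| ≤ B t) →
      (φ i t = B t → φ' i t < B' t) ∧ (φ i t = -B t → -B' t < φ' i t))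
    (i : ι) (t : ℝ) (ht : T ≤ t) : |φ i t| < B t := by
  have key := neg_of_barrier (ι := ι ⊕ ι) (T := T)
    (ψ := Sum.elim (fun i t => φ i t - B t) (fun i t => -φ i t - B t))
    (ψ' := Sum.elim (fun i t => φ' i t - B' t) (fun i t => -φ' i t - B' t)) ?_ ?_ ?_
  · have h1 := key (Sum.inl i) t ht
    have h2 := key (Sum.inr i) t ht
    simp only [Sum.elim_inl, Sum.elim_inr] at h1 h2
    exact abs_lt.2 ⟨by linarith, by linarith⟩
  · rintro (i | i) t ht
    · exact (hd i t ht).sub (hB t ht)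
    · exact (hd i t ht).neg.sub (hB t ht)
  · rintro (i | i) <;> have := abs_lt.1 (h0 i) <;> simp only [Sum.elim_inl, Sum.elim_inr] <;>
      linarith
  · intro i t ht hle hz
    have hall : ∀ j, |φ j t| ≤ B t := fun j => by
      have h1 := hle (Sum.inl j)
      have h2 := hle (Sum.inr j)
      simp only [Sum.elim_inl, Sum.elim_inr] at h1 h2
      exact abs_le.2 ⟨by linarith, by linarith⟩
    rcases i with i | i <;> simp only [Sum.elim_inl, Sum.elim_inr] at hz ⊢
    · linarith [(hb i t ht hall).1 (by linarith)]
    · linarith [(hb i t ht hall).2 (by linarith)]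

section Critic

variable {X A : Type*} [Fintype X] [Fintype A] {p : X → A → X → ℝ} {γ : ℝ}

lemma exists_stationary_lower_bound [Nonempty X] [Nonempty A] [DecidableEq X] [DecidableEq A]
    (hp0 : ∀ x a x', 0 ≤ p x a x') (pista : (X → A → ℝ) → X × A → ℝ)
    (hpi : ∀ (η : ℝ) (θ : X → A → ℝ), 0 ≤ η → η < 1 →
      IsStationaryDist (criticKer p (explorePol η θ)) (pista (explorePol η θ)))
    (herg : ∃ n, 0 < n ∧
      ∀ ξ ξ' : X × A, 0 < kpow (criticKer p (explorePol 0 fun _ _ => 0)) n ξ ξ') :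
    ∃ (n : ℕ) (δ : ℝ), 0 < δ ∧ ∀ (η : ℝ) (θ : X → A → ℝ), 0 ≤ η → η < 1 →
      ∀ ξ, η ^ n * δ ≤ pista (explorePol η θ) ξ := by
  obtain ⟨n, -, hn⟩ := herg
  obtain ⟨ξ₀, hξ₀⟩ := Finite.exists_min fun ξ : (X × A) × (X × A) =>
    kpow (criticKer p (explorePol 0 fun _ _ => 0)) n ξ.1 ξ.2
  refine ⟨n, _, hn ξ₀.1 ξ₀.2, fun η θ h0 h1 ξ => ?_⟩
  have hu : ∀ x a, explorePol (X := X) (A := A) 0 (fun _ _ => 0) x a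
      = 1 / (Fintype.card A : ℝ) := fun x a => by simp [explorePol, softmaxPol]
  refine (hpi η θ h0 h1).lower_bound h0 (fun ξ ξ' => ?_) (fun ξ ξ' => ?_)
    (fun ξ ξ' => hξ₀ (ξ, ξ')) ξ
  · exact mul_nonneg (hp0 _ _ _) (by rw [hu]; positivity)
  · simp only [criticKer, hu]
    have h2 : η * (1 / (Fintype.card A : ℝ)) ≤ explorePol η θ ξ'.1 ξ'.2 := by
      have := mul_nonneg (sub_nonneg.2 h1.le) ((isPolicy_softmaxPol θ).1 ξ'.1 ξ'.2)
      rw [mul_one_div]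
      unfold explorePol
      linarith
    calc η * (p ξ.1 ξ.2 ξ'.1 * (1 / (Fintype.card A : ℝ)))
        = p ξ.1 ξ.2 ξ'.1 * (η * (1 / (Fintype.card A : ℝ))) := by ring
      _ ≤ p ξ.1 ξ.2 ξ'.1 * explorePol η θ ξ'.1 ξ'.2 := mul_le_mul_of_nonneg_left h2 (hp0 _ _ _)

lemma critic_bounded {r : X → A → ℝ} {w Q g : ℝ → X → A → ℝ} {T : ℝ}
    (hp0 : ∀ x a x', 0 ≤ p x a x') (hp1 : ∀ x a, ∑ x', p x a x' = 1)
    (hγ0 : 0 ≤ γ) (hγ1 : γ < 1) (hr : ∀ x a, |r x a| ≤ 1)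
    (hg : ∀ t, T ≤ t → IsPolicy (g t)) (hw : ∀ t, T ≤ t → ∀ x a, 0 < w t x a)
    (hQ : ∀ t, T ≤ t → ∀ x a, HasDerivAt (fun s => Q s x a)
      (w t x a * (r x a + γ * nextMean p (g t) (Q t) x a - Q t x a)) t) :
    ∃ M, ∀ t, T ≤ t → ∀ x a, |Q t x a| ≤ M := by
  have h1γ : 0 < 1 - γ := by linarith
  let M : ℝ := ∑ ξ : X × A, |Q T ξ.1 ξ.2| + 1 / (1 - γ) + 1
  have hM : ∀ x a, |Q T x a| < M := fun x a => by
    have := Finset.single_le_sum (f := fun ξ : X × A => |Q T ξ.1 ξ.2|)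
      (fun _ _ => abs_nonneg _) (Finset.mem_univ (x, a))
    have : 0 < 1 / (1 - γ) := by positivity
    simp only [M]
    linarith
  have hM1 : 1 < (1 - γ) * M := by
    have h2 : 1 / (1 - γ) < M := by
      have := Finset.sum_nonneg (f := fun ξ : X × A => |Q T ξ.1 ξ.2|) (s := Finset.univ)
        (fun _ _ => abs_nonneg _)
      simp only [M]
      linarith
    rwa [div_lt_iff₀' h1γ] at h2
  refine ⟨M, fun t ht x a => ?_⟩
  refine (abs_lt_of_barrier (ι := X × A) (φ := fun ξ s => Q s ξ.1 ξ.2) (B := fun _ => M)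
    (B' := fun _ => 0) (fun ξ s hs => hQ s hs ξ.1 ξ.2) (fun s _ => hasDerivAt_const s M)
    (fun ξ => hM ξ.1 ξ.2) (fun ξ s hs hall => ?_) (x, a) t ht).le
  have hN := abs_le.1 (abs_nextMean_le hp0 hp1 (hg s hs) (fun x a => hall (x, a)) ξ.1 ξ.2)
  have hrξ := abs_le.1 (hr ξ.1 ξ.2)
  have hwξ := hw s hs ξ.1 ξ.2
  constructor <;> intro h
  · refine mul_neg_of_pos_of_neg hwξ ?_
    nlinarith [mul_le_mul_of_nonneg_left hN.2 hγ0]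
  · rw [neg_zero]
    refine mul_pos hwξ ?_
    nlinarith [mul_le_mul_of_nonneg_left hN.1 hγ0]

/-- A perturbed critic error, contracting at a rate bounded below by a power of the exploration
rate, is eventually of the order of the exploration rate. -/
lemma critic_error_bound {w D g e₁ e₂ : ℝ → X → A → ℝ} {T₁ c C₁ C₂ : ℝ} {n : ℕ}
    (hp0 : ∀ x a x', 0 ≤ p x a x') (hp1 : ∀ x a, ∑ x', p x a x' = 1)
    (hγ0 : 0 ≤ γ) (hγ1 : γ < 1) (hT₁ : 0 < T₁) (hc : 0 < c) (hC₁ : 0 ≤ C₁) (hC₂ : 0 ≤ C₂)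
    (hg : ∀ t, T₁ ≤ t → IsPolicy (g t))
    (hw : ∀ t, T₁ ≤ t → ∀ x a, c * etaT t ^ n ≤ w t x a)
    (he₁ : ∀ t, T₁ ≤ t → ∀ x a, |e₁ t x a| ≤ C₁ * etaT t)
    (he₂ : ∀ t, T₁ ≤ t → ∀ x a, |e₂ t x a| ≤ C₂ * zetaT t)
    (hD : ∀ t, T₁ ≤ t → ∀ x a, HasDerivAt (fun s => D s x a)
      (w t x a * (γ * nextMean p (g t) (D t) x a - D t x a + e₁ t x a) - e₂ t x a) t) :
    ∃ T K, T₁ ≤ T ∧ ∀ t, T ≤ t → ∀ x a, |D t x a| ≤ K * etaT t := by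
  have h1γ : 0 < 1 - γ := by linarith
  obtain ⟨T₂, hT₂⟩ := eventually_atTop.1 (eventually_zetaT_lt (C := C₂ + 1)
    (c := c * ((1 - γ) / 2)) (by positivity) (n + 1))
  let T := max T₁ T₂
  let K : ℝ := 1 + C₁ * 2 / (1 - γ) + (∑ ξ : X × A, |D T ξ.1 ξ.2|) / etaT T
  have hsum : 0 ≤ ∑ ξ : X × A, |D T ξ.1 ξ.2| := Finset.sum_nonneg fun _ _ => abs_nonneg _
  have hηT := etaT_pos T
  have hKC : 0 ≤ C₁ * 2 / (1 - γ) := by positivity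
  have hKS : 0 ≤ (∑ ξ : X × A, |D T ξ.1 ξ.2|) / etaT T := by positivity
  have hK1 : 1 ≤ K := by simp only [K]; linarith
  have hK2 : C₁ ≤ (1 - γ) * K / 2 := by
    have : C₁ * 2 / (1 - γ) ≤ K := by simp only [K]; linarith
    rw [div_le_iff₀ h1γ] at this
    linarith
  have hKT : ∀ x a, |D T x a| < K * etaT T := fun x a => by
    have h1 := Finset.single_le_sum (f := fun ξ : X × A => |D T ξ.1 ξ.2|)
      (fun _ _ => abs_nonneg _) (Finset.mem_univ (x, a))
    have h2 : (∑ ξ : X × A, |D T ξ.1 ξ.2|) / etaT T < K := by simp only [K]; linarith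
    rw [div_lt_iff₀ hηT] at h2
    exact h1.trans_lt h2
  refine ⟨T, K, le_max_left _ _, fun t ht x a => ?_⟩
  refine (abs_lt_of_barrier (ι := X × A) (φ := fun ξ s => D s ξ.1 ξ.2)
    (B := fun s => K * etaT s)
    (B' := fun s => K * -(2 * Real.log (s + 1) * zetaT s * etaT s ^ 2))
    (fun ξ s hs => hD s ((le_max_left _ _).trans hs) ξ.1 ξ.2)
    (fun s hs => (hasDerivAt_etaT (hT₁.le.trans ((le_max_left _ _).trans hs))).const_mul K)
    (fun ξ => hKT ξ.1 ξ.2) (fun ξ s hs hall => ?_) (x, a) t ht).le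
  have hs₁ : T₁ ≤ s := (le_max_left _ _).trans hs
  have hη := etaT_pos s
  have hη1 := (etaT_lt_one (hT₁.trans_le hs₁)).le
  have hζ : 0 < zetaT s := inv_pos.2 (by linarith)
  have hN := abs_le.1 (abs_nextMean_le hp0 hp1 (hg s hs₁) (fun x a => hall (x, a)) ξ.1 ξ.2)
  have h1 := abs_le.1 (he₁ s hs₁ ξ.1 ξ.2)
  have h2 := abs_le.1 (he₂ s hs₁ ξ.1 ξ.2)
  have hwξ := hw s hs₁ ξ.1 ξ.2
  have hrate : (C₂ + 1) * zetaT s < c * ((1 - γ) / 2) * etaT s ^ (n + 1) :=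
    hT₂ s ((le_max_right _ _).trans hs)
  have hrate' := mul_lt_mul_of_pos_left hrate (zero_lt_one.trans_le hK1)
  have hlog : 2 * Real.log (s + 1) * zetaT s * etaT s ^ 2 ≤ zetaT s := by
    calc 2 * Real.log (s + 1) * zetaT s * etaT s ^ 2
        = (2 * Real.log (s + 1) * etaT s) * (zetaT s * etaT s) := by ring
      _ ≤ 1 * (zetaT s * etaT s) :=
        mul_le_mul_of_nonneg_right (two_log_mul_etaT_le s) (by positivity)
      _ ≤ zetaT s := by nlinarith
  have hlog' := mul_le_mul_of_nonneg_left hlog (zero_le_one.trans hK1)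
  have hC₂K : C₂ * zetaT s ≤ K * (C₂ * zetaT s) :=
    le_mul_of_one_le_left (by positivity) hK1
  have hC₁η : C₁ * etaT s ≤ (1 - γ) * K / 2 * etaT s := mul_le_mul_of_nonneg_right hK2 hη.le
  have hcon : c * etaT s ^ n * ((1 - γ) * K / 2 * etaT s)
      ≤ w s ξ.1 ξ.2 * ((1 - γ) * K / 2 * etaT s) :=
    mul_le_mul_of_nonneg_right hwξ (by positivity)
  have hpow : c * etaT s ^ n * ((1 - γ) * K / 2 * etaT s)
      = K * (c * ((1 - γ) / 2) * etaT s ^ (n + 1)) := by ring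
  have hw0 : 0 ≤ w s ξ.1 ξ.2 := le_trans (by positivity) hwξ
  constructor <;> intro h
  · have : γ * nextMean p (g s) (D s) ξ.1 ξ.2 - D s ξ.1 ξ.2 + e₁ s ξ.1 ξ.2
        ≤ -((1 - γ) * K / 2 * etaT s) := by
      linarith [mul_le_mul_of_nonneg_left hN.2 hγ0]
    have := mul_le_mul_of_nonneg_left this hw0
    linarith
  · have : (1 - γ) * K / 2 * etaT s
        ≤ γ * nextMean p (g s) (D s) ξ.1 ξ.2 - D s ξ.1 ξ.2 + e₁ s ξ.1 ξ.2 := by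
      linarith [mul_le_mul_of_nonneg_left hN.1 hγ0]
    have := mul_le_mul_of_nonneg_left this hw0
    linarith

end Critic

section Actor

variable {A : Type*} [Fintype A] {w q v θ' : A → ℝ} {z m : ℝ}

lemma abs_sub_weighted_sum_le {B : ℝ} (hw : ∀ a, 0 ≤ w a) (hw1 : ∑ a, w a = 1)
    (hv : ∀ a, |v a| ≤ B) (a : A) : |v a - ∑ b, w b * v b| ≤ 2 * B := by
  have h1 := abs_le.1 (hv a)
  have h2 := abs_le.1 (abs_weighted_sum_le hw hw1 hv)
  exact abs_le.2 ⟨by linarith, by linarith⟩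

/-- Policy improvement at one state: a natural ascent direction computed with an `ε`-accurate
critic decreases the objective at most quadratically in `ε`. -/
lemma actor_ascent_lower_bound {ε : ℝ} (hw : ∀ a, 0 ≤ w a) (hw1 : ∑ a, w a = 1) (hz : 0 ≤ z)
    (hm0 : 0 ≤ m) (hm1 : m ≤ 1) (hθ : ∀ a, θ' a = z * (m * w a) * (q a - ∑ b, w b * q b))
    (hqv : ∀ a, |q a - v a| ≤ ε) :
    -(z * ε ^ 2) ≤ ∑ a, w a * (θ' a * (v a - ∑ b, w b * v b)) := by
  refine le_weighted_sum hw hw1 fun a => ?_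
  have hδ := abs_sub_weighted_sum_le hw hw1 hqv a
  have hw' : w a ≤ 1 := hw1 ▸ Finset.single_le_sum (fun b _ => hw b) (Finset.mem_univ a)
  have hmw : m * w a ≤ 1 := mul_le_one₀ hm1 (hw a) hw'
  have hsplit : q a - ∑ b, w b * q b
      = (v a - ∑ b, w b * v b) + (q a - v a - ∑ b, w b * (q b - v b)) := by
    simp only [mul_sub, Finset.sum_sub_distrib]
    ring
  rw [hθ, hsplit]
  set d := q a - v a - ∑ b, w b * (q b - v b)
  set y := v a - ∑ b, w b * v b
  have hd : d ^ 2 ≤ (2 * ε) ^ 2 := sq_le_sq' (by linarith [(abs_le.1 hδ).1]) (abs_le.1 hδ).2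
  have hquad : -ε ^ 2 ≤ (y + d) * y := by nlinarith [sq_nonneg (2 * y + d)]
  have hzmw : 0 ≤ z * (m * w a) := mul_nonneg hz (mul_nonneg hm0 (hw a))
  have hle : z * (m * w a) ≤ z := mul_le_of_le_one_right hz hmw
  calc -(z * ε ^ 2) ≤ z * (m * w a) * -ε ^ 2 := by nlinarith [sq_nonneg ε]
    _ ≤ z * (m * w a) * ((y + d) * y) := mul_le_mul_of_nonneg_left hquad hzmw
    _ = z * (m * w a) * (y + d) * y := by ring

lemma actor_ascent_abs_le {M B : ℝ} (hw : ∀ a, 0 ≤ w a) (hw1 : ∑ a, w a = 1) (hz : 0 ≤ z)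
    (hm0 : 0 ≤ m) (hm1 : m ≤ 1) (hθ : ∀ a, θ' a = z * (m * w a) * (q a - ∑ b, w b * q b))
    (hq : ∀ a, |q a| ≤ M) (hv : ∀ a, |v a| ≤ B) :
    |∑ a, w a * (θ' a * (v a - ∑ b, w b * v b))| ≤ 4 * M * B * z := by
  refine abs_weighted_sum_le hw hw1 fun a => ?_
  have hM : 0 ≤ M := (abs_nonneg _).trans (hq a)
  have hw' : w a ≤ 1 := hw1 ▸ Finset.single_le_sum (fun b _ => hw b) (Finset.mem_univ a)
  have hle : |z * (m * w a)| ≤ z := by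
    rw [abs_of_nonneg (mul_nonneg hz (mul_nonneg hm0 (hw a)))]
    exact mul_le_of_le_one_right hz (mul_le_one₀ hm1 (hw a) hw')
  rw [hθ, abs_mul, abs_mul]
  calc _ ≤ z * (2 * M) * (2 * B) := by
        gcongr
        · exact abs_sub_weighted_sum_le hw hw1 hq a
        · exact abs_sub_weighted_sum_le hw hw1 hv a
    _ = 4 * M * B * z := by ring

end Actor

theorem value_functions_converge_along_flow
    {X A : Type*} [Fintype X] [Fintype A] [Nonempty X] [Nonempty A]
    [DecidableEq X] [DecidableEq A]
    (p : X → A → X → ℝ) (μ : X → ℝ) (r : X → A → ℝ) (γ α : ℝ)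
    (hp0 : ∀ x a x', 0 ≤ p x a x') (hp1 : ∀ x a, ∑ x', p x a x' = 1)
    (hμ0 : ∀ x, 0 ≤ μ x) (hμ1 : ∑ x, μ x = 1)
    (hr : ∀ x a, 0 ≤ r x a ∧ r x a ≤ 1) (hγ : 0 < γ ∧ γ < 1) (hα : 0 < α)
    (sigsta : (X → A → ℝ) → X × A → ℝ)
    (hsig : ∀ θ : X → A → ℝ,
      IsStationaryDist (actorKer γ p μ (softmaxPol θ)) (sigsta (softmaxPol θ)))
    (hsigLip : ∃ L : ℝ, ∀ f f' : X → A → ℝ,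
      ∑ ξ : X × A, |sigsta f ξ - sigsta f' ξ| ≤ L * ∑ x, ∑ a, |f x a - f' x a|)
    (hergA : ∀ θ : X → A → ℝ, ∃ n, 0 < n ∧
      ∀ ξ ξ' : X × A, 0 < kpow (actorKer γ p μ (softmaxPol θ)) n ξ ξ')
    (pista : (X → A → ℝ) → X × A → ℝ)
    (hpi : ∀ (η : ℝ) (θ : X → A → ℝ), 0 ≤ η → η < 1 →
      IsStationaryDist (criticKer p (explorePol η θ)) (pista (explorePol η θ)))
    (hpiLip : ∃ L : ℝ, ∀ f f' : X → A → ℝ,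
      ∑ ξ : X × A, |pista f ξ - pista f' ξ| ≤ L * ∑ x, ∑ a, |f x a - f' x a|)
    (hergC : ∀ (η : ℝ) (θ : X → A → ℝ), 0 ≤ η → η < 1 → ∃ n, 0 < n ∧
      ∀ ξ ξ' : X × A, 0 < kpow (criticKer p (explorePol η θ)) n ξ ξ')
    (Qb θb : ℝ → X → A → ℝ)
    (hQode : ∀ t, 0 ≤ t → ∀ x a, HasDerivAt (fun s => Qb s x a)
      (α * pista (explorePol (etaT t) (θb t)) (x, a) *
        (r x a + γ * (∑ z, ∑ a'', Qb t z a'' * explorePol (etaT t) (θb t) z a'' * p x a z)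
          - Qb t x a)) t)
    (hθode : ∀ t, 0 ≤ t → ∀ x a, HasDerivAt (fun s => θb s x a)
      (zetaT t * sigsta (softmaxPol (θb t)) (x, a) *
        (Qb t x a - ∑ a', Qb t x a' * softmaxPol (θb t) x a')) t)
    (Vq : (X → A → ℝ) → X → A → ℝ)
    (hVq : ∀ f : X → A → ℝ, IsPolicy f → ∀ x a,
      Vq f x a = r x a + γ * ∑ x', p x a x' * ∑ a', f x' a' * Vq f x' a')
    :
    ∃ Vinf : X → ℝ, ∃ Vinfq : X → A → ℝ,
      (∀ x, Tendsto (fun t => ∑ a, softmaxPol (θb t) x a * Vq (softmaxPol (θb t)) x a)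
        atTop (nhds (Vinf x))) ∧
      (∀ x a, Tendsto (fun t => Vq (softmaxPol (θb t)) x a) atTop (nhds (Vinfq x a))) ∧
      (∀ x a, Tendsto (fun t => Qb t x a) atTop (nhds (Vinfq x a))) ∧
      (∀ x, Tendsto (fun t => ∑ a, Qb t x a * softmaxPol (θb t) x a)
        atTop (nhds (Vinf x))) ∧
      (0 < sInf {d : ℝ | ∃ x a, Vinfq x a ≠ Vinf x ∧ d = |Vinfq x a - Vinf x|} →
        ∃ T₀ : ℝ, ∀ t, T₀ < t → ∀ x a,
          Vinfq x a - sInf {d : ℝ | ∃ x a, Vinfq x a ≠ Vinf x ∧ d = |Vinfq x a - Vinf x|} / 4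
              ≤ Qb t x a ∧
            Qb t x a ≤ Vinfq x a +
              sInf {d : ℝ | ∃ x a, Vinfq x a ≠ Vinf x ∧ d = |Vinfq x a - Vinf x|} / 4) := by
  obtain ⟨hγ0, hγ1⟩ := hγ
  have h1γ : 0 < 1 - γ := by linarith
  let f : ℝ → X → A → ℝ := fun t => softmaxPol (θb t)
  let g : ℝ → X → A → ℝ := fun t => explorePol (etaT t) (θb t)
  let V : ℝ → X → A → ℝ := fun t => Vq (f t)
  have hf : ∀ t, IsPolicy (f t) := fun t => isPolicy_softmaxPol _
  have hg : ∀ t, 1 ≤ t → IsPolicy (g t) := fun t ht =>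
    isPolicy_explorePol (etaT_pos t).le (etaT_lt_one (by linarith)).le _
  have hV : ∀ t x a, V t x a = r x a + γ * nextMean p (f t) (V t) x a :=
    fun t => hVq (f t) (hf t)
  have hr' : ∀ x a, |r x a| ≤ 1 := fun x a => abs_le.2 ⟨by linarith [(hr x a).1], (hr x a).2⟩
  have hVB : ∀ t x a, |V t x a| ≤ 1 / (1 - γ) := fun t =>
    abs_le_of_bellman_eq hp0 hp1 (hf t) hγ0.le hγ1 (hV t) hr'
  have hvB : ∀ t x, |∑ a, f t x a * V t x a| ≤ 1 / (1 - γ) := fun t x =>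
    abs_weighted_sum_le ((hf t).1 x) ((hf t).2 x) (hVB t x)
  have hζ : ∀ t, 1 ≤ t → 0 < zetaT t := fun t ht => inv_pos.2 (by linarith)
  -- the critic: uniform lower bound on its rate, and boundedness
  obtain ⟨n, δ, hδ, hlow⟩ := exists_stationary_lower_bound hp0 pista hpi
    (hergC 0 (fun _ _ => 0) le_rfl zero_lt_one)
  let w : ℝ → X → A → ℝ := fun t x a => α * pista (g t) (x, a)
  have hw : ∀ t, 1 ≤ t → ∀ x a, α * δ * etaT t ^ n ≤ w t x a := fun t ht x a => by
    have := mul_le_mul_of_nonneg_left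
      (hlow (etaT t) (θb t) (etaT_pos t).le (etaT_lt_one (by linarith)) (x, a)) hα.le
    simp only [w, g]
    linarith
  have hw0 : ∀ t, 1 ≤ t → ∀ x a, 0 < w t x a := fun t ht x a => by
    have := etaT_pos t
    exact lt_of_lt_of_le (by positivity) (hw t ht x a)
  have hQ : ∀ t, 1 ≤ t → ∀ x a, HasDerivAt (fun s => Qb s x a)
      (w t x a * (r x a + γ * nextMean p (g t) (Qb t) x a - Qb t x a)) t := fun t ht x a => by
    refine (hQode t (by linarith) x a).congr_deriv ?_
    have : ∑ z, ∑ a'', Qb t z a'' * explorePol (etaT t) (θb t) z a'' * p x a z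
        = nextMean p (g t) (Qb t) x a := by
      simp only [nextMean, Finset.mul_sum, g]
      exact Finset.sum_congr rfl fun _ _ => Finset.sum_congr rfl fun _ _ => by ring
    rw [this]
  obtain ⟨M, hM⟩ := critic_bounded hp0 hp1 hγ0.le hγ1 hr' hg hw0 hQ
  -- the actor: derivatives of the policy and of its value function
  choose m hm hsm using fun t => (hsig (θb t)).exists_factor (hf t)
  let θ' : ℝ → X → A → ℝ := fun t x a =>
    zetaT t * (m t x * f t x a) * (Qb t x a - ∑ b, f t x b * Qb t x b)
  let f' : ℝ → X → A → ℝ := fun t x a => f t x a * (θ' t x a - ∑ b, f t x b * θ' t x b)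
  have hf' : ∀ t, 1 ≤ t → ∀ x a, HasDerivAt (fun s => f s x a) (f' t x a) t :=
    fun t ht x a => hasDerivAt_softmaxPol (fun a =>
      (hθode t (by linarith) x a).congr_deriv (by
        simp only [θ', hsm, mul_comm (Qb t x _)]
        rfl)) a
  have hgrad : ∀ t x, ∑ a, f' t x a * V t x a
      = ∑ a, f t x a * (θ' t x a * (V t x a - ∑ b, f t x b * V t x b)) :=
    fun t x => sum_softmax_deriv_mul
  choose! E hE hVE using fun t (ht : 1 ≤ t) =>
    exists_hasDerivAt_bellman hp0 hp1 hf hγ0.le hγ1 hV (hf' t ht)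
  let C₂ : ℝ := 4 * |M| * (1 / (1 - γ))
  have hC₂ : 0 ≤ C₂ := by positivity
  have hEabs : ∀ t, 1 ≤ t → ∀ x a, |E t x a| ≤ C₂ / (1 - γ) * zetaT t := fun t ht x a => by
    have h := abs_le_of_bellman_eq (ε := C₂ * zetaT t) hp0 hp1 (hf t) hγ0.le hγ1 (hE t ht)
      (fun x a => ?_) x a
    · rwa [div_mul_eq_mul_div]
    · rw [abs_mul, abs_of_pos hγ0]
      have hz := (hζ t ht).le
      have : |nextMean p (f' t) (V t) x a| ≤ C₂ * zetaT t :=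
        abs_weighted_sum_le (hp0 x a) (hp1 x a) fun y => by
          rw [hgrad]
          exact actor_ascent_abs_le ((hf t).1 y) ((hf t).2 y) hz (hm t y).1 (hm t y).2
            (fun _ => rfl) (fun a => (hM t ht y a).trans (le_abs_self M)) (hVB t y)
      exact (mul_le_of_le_one_left (abs_nonneg _) hγ1.le).trans this
  -- the critic tracks the value function of the actor
  let D : ℝ → X → A → ℝ := fun t x a => Qb t x a - V t x a
  let e₁ : ℝ → X → A → ℝ := fun t x a =>
    γ * (nextMean p (g t) (V t) x a - nextMean p (f t) (V t) x a)
  have he₁ : ∀ t, 1 ≤ t → ∀ x a, |e₁ t x a| ≤ 2 * (1 / (1 - γ)) * etaT t := fun t ht x a => by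
    have hη := etaT_pos t
    have hu := (isPolicy_explorePol zero_le_one le_rfl (θb t) : IsPolicy (explorePol 1 (θb t)))
    have hgf : nextMean p (g t) (V t) x a - nextMean p (f t) (V t) x a = etaT t *
        (nextMean p (explorePol 1 (θb t)) (V t) x a - nextMean p (f t) (V t) x a) := by
      simp only [← nextMean_sub_left, ← nextMean_smul_left]
      congr 1
      ext y b
      simp only [g, f, explorePol]
      ring
    have h1 := abs_le.1 (abs_nextMean_le hp0 hp1 hu (hVB t) x a)
    have h2 := abs_le.1 (abs_nextMean_le hp0 hp1 (hf t) (hVB t) x a)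
    have h3 : |nextMean p (explorePol 1 (θb t)) (V t) x a - nextMean p (f t) (V t) x a|
        ≤ 2 * (1 / (1 - γ)) := abs_le.2 ⟨by linarith, by linarith⟩
    simp only [e₁]
    rw [hgf, abs_mul, abs_mul, abs_of_pos hγ0, abs_of_pos hη]
    calc _ ≤ 1 * (etaT t * (2 * (1 / (1 - γ)))) := by gcongr
      _ = 2 * (1 / (1 - γ)) * etaT t := by ring
  have hD : ∀ t, 1 ≤ t → ∀ x a, HasDerivAt (fun s => D s x a)
      (w t x a * (γ * nextMean p (g t) (D t) x a - D t x a + e₁ t x a) - E t x a) t :=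
    fun t ht x a => by
      refine ((hQ t ht x a).sub (hVE t ht x a)).congr_deriv ?_
      simp only [D, e₁, nextMean_sub_right]
      rw [show r x a = V t x a - γ * nextMean p (f t) (V t) x a by linarith [hV t x a]]
      ring
  obtain ⟨T, K, hT, hDK⟩ := critic_error_bound hp0 hp1 hγ0.le hγ1 zero_lt_one
    (mul_pos hα hδ) (by positivity) (by positivity) hg hw he₁ hEabs hD
  have hT0 : 0 ≤ T := zero_le_one.trans hT
  -- the value functions are increasing up to an integrable error
  have hgradlow : ∀ t, T ≤ t → ∀ x, -(K ^ 2 * (zetaT t * etaT t)) ≤ ∑ a, f' t x a * V t x a :=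
    fun t ht x => by
      have h1t : 1 ≤ t := hT.trans ht
      have hη := etaT_pos t
      have hη1 := etaT_lt_one (show 0 < t by linarith)
      have hz := (hζ t h1t).le
      rw [hgrad]
      refine le_trans ?_ (actor_ascent_lower_bound ((hf t).1 x) ((hf t).2 x) hz (hm t x).1
        (hm t x).2 (fun _ => rfl) (hDK t ht x))
      have : etaT t ^ 2 ≤ etaT t := by nlinarith
      calc -(K ^ 2 * (zetaT t * etaT t)) ≤ -(K ^ 2 * (zetaT t * etaT t ^ 2)) := by gcongr
        _ = -(zetaT t * (K * etaT t) ^ 2) := by ring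
  have hElow : ∀ t, T ≤ t → ∀ x a, -(K ^ 2 / (1 - γ) * (zetaT t * etaT t)) ≤ E t x a :=
    fun t ht x a => by
      have h1t : 1 ≤ t := hT.trans ht
      have hη := etaT_pos t
      have hz := hζ t h1t
      rw [div_mul_eq_mul_div]
      refine bellman_lower_bound hp0 hp1 (hf t) hγ0.le hγ1 (fun x a => ?_) x a
      have : -(K ^ 2 * (zetaT t * etaT t)) ≤ nextMean p (f' t) (V t) x a :=
        le_weighted_sum (hp0 x a) (hp1 x a) (hgradlow t ht)
      have h0 : 0 ≤ K ^ 2 * (zetaT t * etaT t) := by positivity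
      rw [hE t h1t x a]
      nlinarith
  have hVlim : ∀ x a, ∃ l, Tendsto (fun t => V t x a) atTop (nhds l) := fun x a =>
    exists_tendsto_of_deriv_lower_bound hT0 (fun t ht => hVE t (hT.trans ht) x a)
      (fun t => hVB t x a) (by positivity) (fun t ht => hElow t ht x a)
  have hvlim : ∀ x, ∃ l, Tendsto (fun t => ∑ a, f t x a * V t x a) atTop (nhds l) := fun x => by
    refine exists_tendsto_of_deriv_lower_bound (C := K ^ 2 + K ^ 2 / (1 - γ)) hT0
      (fun t ht => HasDerivAt.fun_sum fun a (_ : a ∈ Finset.univ) =>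
        (hf' t (hT.trans ht) x a).mul (hVE t (hT.trans ht) x a))
      (fun t => hvB t x) (by positivity) fun t ht => ?_
    rw [Finset.sum_add_distrib]
    linarith [hgradlow t ht x, le_weighted_sum ((hf t).1 x) ((hf t).2 x) (hElow t ht x)]
  choose Vinfq hVinfq using hVlim
  choose Vinf hVinf using hvlim
  have hKη : Tendsto (fun t => K * etaT t) atTop (nhds 0) := by
    simpa using tendsto_etaT.const_mul K
  have hQlim : ∀ x a, Tendsto (fun t => Qb t x a) atTop (nhds (Vinfq x a)) := fun x a => by
    have h0 : Tendsto (fun t => D t x a) atTop (nhds 0) :=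
      squeeze_zero_norm' ((eventually_ge_atTop T).mono fun t ht => hDK t ht x a) hKη
    simpa [D] using h0.add (hVinfq x a)
  refine ⟨Vinf, Vinfq, hVinf, hVinfq, hQlim, fun x => ?_, fun hΔ => ?_⟩
  · have h0 : Tendsto (fun t => ∑ a, f t x a * D t x a) atTop (nhds 0) :=
      squeeze_zero_norm' ((eventually_ge_atTop T).mono fun t ht =>
        abs_weighted_sum_le ((hf t).1 x) ((hf t).2 x) (hDK t ht x)) hKη
    have h1 := h0.add (hVinf x)
    rw [zero_add] at h1
    refine h1.congr fun t => ?_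
    rw [← Finset.sum_add_distrib]
    exact Finset.sum_congr rfl fun a _ => by simp only [D, f]; ring
  · have hev : ∀ᶠ t in atTop, ∀ x a, Qb t x a ∈ Icc
        (Vinfq x a - sInf {d : ℝ | ∃ x a, Vinfq x a ≠ Vinf x ∧ d = |Vinfq x a - Vinf x|} / 4)
        (Vinfq x a + sInf {d : ℝ | ∃ x a, Vinfq x a ≠ Vinf x ∧ d = |Vinfq x a - Vinf x|} / 4) :=
      eventually_all.2 fun x => eventually_all.2 fun a =>
        (hQlim x a).eventually (Icc_mem_nhds (by linarith) (by linarith))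
    obtain ⟨T₀, hT₀⟩ := eventually_atTop.1 hev
    exact ⟨T₀, fun t ht x a => hT₀ t ht.le x a⟩
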